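/- Let n ≥ 2 be an integer and let c be a nonempty list of integers with every entry ≥ 2 such that s(c) = 2ⁿ. Then 𝓢(c) is palindromic if and only if r(c) ≡ ±1 (mod 2ⁿ) or r(c) ≡ 2^{n−1} ± 1 (mod 2ⁿ). -/

import Mathlib

open Polynomial

/-- The `q`-deformation `[n]_q = 1 + q + ⋯ + q^{n-1}` of a nonnegative integer. -/
noncomputable def qNat (n : ℕ) : Polynomial ℤ := (Finset.range n).sum fun i => X ^ i

/-- The matrix `M_q⁻(c) = (([c]_q, -q^{c-1}), (1, 0))` over `ℤ[q]`. -/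
noncomputable def MqNeg (c : ℕ) : Matrix (Fin 2) (Fin 2) (Polynomial ℤ) :=
  !![qNat c, -(X ^ (c - 1)); 1, 0]

/-- `𝓡(c)`: the (0,0) entry of `M_q⁻(c₁)⋯M_q⁻(c_l)`. -/
noncomputable def Rpoly (L : List ℕ) : Polynomial ℤ := ((L.map MqNeg).prod) 0 0

/-- `𝓢(c)`: the (1,0) entry of `M_q⁻(c₁)⋯M_q⁻(c_l)`. -/
noncomputable def Spoly (L : List ℕ) : Polynomial ℤ := ((L.map MqNeg).prod) 1 0

/-- `r(c) = 𝓡(c)(1)`. -/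
noncomputable def rNum (L : List ℕ) : ℤ := (Rpoly L).eval 1

/-- `s(c) = 𝓢(c)(1)`. -/
noncomputable def sNum (L : List ℕ) : ℤ := (Spoly L).eval 1

/-- The total degree `∑ (cᵢ - 1)` of the `q`-continuant of a list. -/
def continuantDegree (L : List ℕ) : ℕ := (L.map fun c => c - 1).sum

/-- The specialization of `MqNeg c` at `q = 1`. -/
def matNeg (c : ℕ) : Matrix (Fin 2) (Fin 2) ℤ := !![(c : ℤ), -1; 1, 0]

/-- The product of the matrices `matNeg` along a list. -/
def matProd (L : List ℕ) : Matrix (Fin 2) (Fin 2) ℤ := (L.map matNeg).prod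

@[simp] lemma continuantDegree_nil : continuantDegree [] = 0 := rfl

@[simp] lemma continuantDegree_cons (c : ℕ) (L : List ℕ) :
    continuantDegree (c :: L) = (c - 1) + continuantDegree L := by
  simp [continuantDegree]

@[simp] lemma Rpoly_nil : Rpoly [] = 1 := by simp [Rpoly]

@[simp] lemma Spoly_nil : Spoly [] = 0 := by simp [Spoly]

@[simp] lemma Rpoly_cons (c : ℕ) (L : List ℕ) :
    Rpoly (c :: L) = qNat c * Rpoly L - X ^ (c - 1) * Spoly L := by
  simp [Rpoly, Spoly, MqNeg, Matrix.mul_apply, Fin.sum_univ_two, sub_eq_add_neg]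

@[simp] lemma Spoly_cons (c : ℕ) (L : List ℕ) : Spoly (c :: L) = Rpoly L := by
  simp [Rpoly, Spoly, MqNeg, Matrix.mul_apply, Fin.sum_univ_two]

lemma Rpoly_append_singleton (L : List ℕ) (c : ℕ) :
    Rpoly (L ++ [c]) = Rpoly L * qNat c + ((L.map MqNeg).prod) 0 1 := by
  simp [Rpoly, MqNeg, Matrix.mul_apply, Fin.sum_univ_two]

lemma Rpoly_append_pair (L : List ℕ) (c c' : ℕ) :
    Rpoly (L ++ [c', c]) = Rpoly (L ++ [c']) * qNat c - X ^ (c' - 1) * Rpoly L := by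
  have h : L ++ [c', c] = (L ++ [c']) ++ [c] := by simp
  rw [h, Rpoly_append_singleton (L ++ [c'])]
  simp [Rpoly, MqNeg, Matrix.mul_apply, Fin.sum_univ_two]
  ring

@[simp] lemma matProd_nil : matProd [] = 1 := rfl

lemma matProd_cons (c : ℕ) (L : List ℕ) : matProd (c :: L) = matNeg c * matProd L := by
  simp [matProd]

@[simp] lemma matProd_cons_zero (c : ℕ) (L : List ℕ) (j : Fin 2) :
    matProd (c :: L) 0 j = c * matProd L 0 j - matProd L 1 j := by
  simp [matProd_cons, matNeg, Matrix.mul_apply, Fin.sum_univ_two, sub_eq_add_neg]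

@[simp] lemma matProd_cons_one (c : ℕ) (L : List ℕ) (j : Fin 2) :
    matProd (c :: L) 1 j = matProd L 0 j := by
  simp [matProd_cons, matNeg, Matrix.mul_apply, Fin.sum_univ_two]

lemma det_matProd (L : List ℕ) :
    matProd L 0 0 * matProd L 1 1 - matProd L 0 1 * matProd L 1 0 = 1 := by
  induction L with
  | nil => simp
  | cons c L ih => simp only [matProd_cons_zero, matProd_cons_one]; linarith

lemma matProd_reverse (L : List ℕ) :
    matProd L.reverse = !![matProd L 0 0, -matProd L 1 0; -matProd L 0 1, matProd L 1 1] := by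
  induction L with
  | nil => ext i j; fin_cases i <;> fin_cases j <;> simp
  | cons c L ih =>
    have h : matProd (L.reverse ++ [c]) = matProd L.reverse * matNeg c := by simp [matProd]
    rw [List.reverse_cons, h, ih]
    ext i j
    fin_cases i <;> fin_cases j <;>
      simp [matNeg, Matrix.mul_apply, Fin.sum_univ_two] <;> ring

lemma natDegree_qNat_le (c : ℕ) : (qNat c).natDegree ≤ c - 1 := by
  refine natDegree_sum_le_of_forall_le _ _ fun i hi => ?_
  rw [natDegree_X_pow]
  have := Finset.mem_range.1 hi
  omega

lemma reflect_qNat (c : ℕ) : (qNat c).reflect (c - 1) = qNat c := by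
  ext i
  simp only [coeff_reflect, qNat, finsetSum_coeff, coeff_X_pow, Finset.sum_ite_eq,
    Finset.mem_range]
  congr 1
  rcases le_or_gt i (c - 1) with h | h
  · rw [revAt_le h]
    exact propext (by omega)
  · rw [revAt_eq_self_of_lt h]

lemma natDegree_Rpoly_le : ∀ L : List ℕ, (∀ y ∈ L, 2 ≤ y) →
    (Rpoly L).natDegree ≤ continuantDegree L ∧ (Spoly L).natDegree ≤ continuantDegree L := by
  intro L hL
  induction L with
  | nil => simp
  | cons c L ih =>
    obtain ⟨h1, h2⟩ := ih fun y hy => hL y (List.mem_cons_of_mem _ hy)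
    rw [Rpoly_cons, Spoly_cons, continuantDegree_cons]
    refine ⟨(natDegree_sub_le _ _).trans (max_le ?_ ?_), by omega⟩
    · exact natDegree_mul_le.trans (add_le_add (natDegree_qNat_le c) h1)
    · exact natDegree_mul_le.trans (add_le_add (natDegree_X_pow_le _) h2)

lemma reflect_Rpoly : ∀ L : List ℕ, (∀ y ∈ L, 2 ≤ y) →
    (Rpoly L).reflect (continuantDegree L) = Rpoly L.reverse
  | [], _ => by simp
  | [c], _ => by simp [reflect_qNat]
  | c :: c' :: T, hL => by
    have hL' : ∀ y ∈ c' :: T, 2 ≤ y := fun y hy => hL y (List.mem_cons_of_mem _ hy)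
    have hT : ∀ y ∈ T, 2 ≤ y := fun y hy => hL' y (List.mem_cons_of_mem _ hy)
    have e : (c :: c' :: T).reverse = T.reverse ++ [c', c] := by simp
    have e' : (c' :: T).reverse = T.reverse ++ [c'] := by simp
    have hX : (X ^ (c - 1) : ℤ[X]).reflect (c - 1) = 1 := by
      rw [reflect_monomial]; simp
    have h1 : (1 : ℤ[X]).reflect (c' - 1) = X ^ (c' - 1) := by simp
    rw [e, Rpoly_append_pair, ← e', ← reflect_Rpoly _ hL', ← reflect_Rpoly _ hT,
      Rpoly_cons c, continuantDegree_cons c, reflect_sub,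
      reflect_mul _ _ (natDegree_qNat_le c) (natDegree_Rpoly_le _ hL').1, reflect_qNat,
      reflect_mul _ _ (natDegree_X_pow_le _) (natDegree_Rpoly_le _ hL').2, hX, one_mul,
      Spoly_cons, continuantDegree_cons c' T, mul_comm]
    congr 1
    conv_lhs => rw [← one_mul (Rpoly T)]
    rw [reflect_mul _ _ (by simp) (natDegree_Rpoly_le _ hT).1, h1]

lemma coeff_zero_Rpoly (L : List ℕ) (hL : ∀ y ∈ L, 2 ≤ y) : (Rpoly L).coeff 0 = 1 := by
  induction L with
  | nil => simp
  | cons c L ih =>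
    have hc : 2 ≤ c := hL c (by simp)
    have hq : (qNat c).coeff 0 = 1 := by
      simp only [qNat, finsetSum_coeff, coeff_X_pow, Finset.sum_ite_eq, Finset.mem_range]
      exact if_pos (by omega)
    have hX : (X ^ (c - 1) : ℤ[X]).coeff 0 = 0 := by
      rw [coeff_X_pow]
      exact if_neg (by omega)
    rw [Rpoly_cons, coeff_sub, mul_coeff_zero, mul_coeff_zero,
      ih fun y hy => hL y (List.mem_cons_of_mem _ hy), hq, hX]
    simp

lemma reverse_Rpoly (L : List ℕ) (hL : ∀ y ∈ L, 2 ≤ y) :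
    (Rpoly L).reverse = Rpoly L.reverse := by
  have hd : (Rpoly L).natDegree = continuantDegree L := by
    refine le_antisymm (natDegree_Rpoly_le L hL).1 (le_natDegree_of_ne_zero ?_)
    have h := coeff_zero_Rpoly L.reverse (by simpa using hL)
    rw [← reflect_Rpoly L hL, coeff_reflect, revAt_le (Nat.zero_le _), Nat.sub_zero] at h
    simp [h]
  rw [Polynomial.reverse, hd, reflect_Rpoly L hL]

lemma eval_one_qNat (c : ℕ) : (qNat c).eval 1 = c := by
  simp [qNat, eval_finsetSum]

lemma two_mul_eval_one_derivative_qNat (c : ℕ) :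
    2 * (derivative (qNat c)).eval 1 = (c : ℤ) * (c - 1) := by
  induction c with
  | zero => simp [qNat]
  | succ c ih =>
    have h : qNat (c + 1) = qNat c + X ^ c := Finset.sum_range_succ _ _
    rw [h, derivative_add, eval_add, mul_add, ih, derivative_X_pow]
    simp
    ring

lemma eval_one_Rpoly_Spoly (L : List ℕ) :
    (Rpoly L).eval 1 = matProd L 0 0 ∧ (Spoly L).eval 1 = matProd L 1 0 := by
  induction L with
  | nil => simp
  | cons c L ih => simp [ih.1, ih.2, eval_one_qNat]

lemma two_mul_eval_one_derivative (L : List ℕ) (hL : ∀ y ∈ L, 2 ≤ y) :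
    2 * (derivative (Rpoly L)).eval 1 =
        continuantDegree L * matProd L 0 0 + matProd L 1 0 + matProd L 0 1 ∧
      2 * (derivative (Spoly L)).eval 1 =
        (continuantDegree L + 1) * matProd L 1 0 - matProd L 0 0 + matProd L 1 1 := by
  induction L with
  | nil => simp
  | cons c L ih =>
    have hc : 2 ≤ c := hL c (by simp)
    obtain ⟨h1, h2⟩ := ih fun y hy => hL y (List.mem_cons_of_mem _ hy)
    obtain ⟨hR, hS⟩ := eval_one_Rpoly_Spoly L
    have hq := two_mul_eval_one_derivative_qNat c
    have hcast : ((c - 1 : ℕ) : ℤ) = c - 1 := by push_cast [show 1 ≤ c by omega]; ring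
    simp only [Rpoly_cons, Spoly_cons, continuantDegree_cons, matProd_cons_zero,
      matProd_cons_one, derivative_sub, derivative_mul, derivative_X_pow, eval_sub, eval_add,
      eval_mul, eval_pow, eval_X, one_pow, eval_one_qNat, hR, hS, Nat.cast_add, hcast,
      eval_C]
    constructor
    · linear_combination matProd L 0 0 * hq + (c : ℤ) * h1 - h2
    · linear_combination h1

lemma matProd_bounds (L : List ℕ) (hL : ∀ y ∈ L, 2 ≤ y) :
    0 ≤ matProd L 1 0 ∧ matProd L 1 0 < matProd L 0 0 := by
  induction L with
  | nil => simp
  | cons c L ih =>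
    have hc : (2 : ℤ) ≤ c := by exact_mod_cast hL c (by simp)
    obtain ⟨h1, h2⟩ := ih fun y hy => hL y (List.mem_cons_of_mem _ hy)
    simp only [matProd_cons_zero, matProd_cons_one]
    constructor
    · omega
    · nlinarith

lemma eq_of_matProd_eq (L L' : List ℕ) (hL : ∀ y ∈ L, 2 ≤ y) (hL' : ∀ y ∈ L', 2 ≤ y)
    (h0 : matProd L 0 0 = matProd L' 0 0) (h1 : matProd L 1 0 = matProd L' 1 0) : L = L' := by
  induction L generalizing L' with
  | nil =>
    cases L' with
    | nil => rfl
    | cons c' T' =>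
      have := matProd_bounds T' fun y hy => hL' y (List.mem_cons_of_mem _ hy)
      simp at h1
      omega
  | cons c T ih =>
    have hT : ∀ y ∈ T, 2 ≤ y := fun y hy => hL y (List.mem_cons_of_mem _ hy)
    have hb := matProd_bounds T hT
    cases L' with
    | nil =>
      simp at h1
      omega
    | cons c' T' =>
      have hT' : ∀ y ∈ T', 2 ≤ y := fun y hy => hL' y (List.mem_cons_of_mem _ hy)
      have hb' := matProd_bounds T' hT'
      simp only [matProd_cons_zero, matProd_cons_one] at h0 h1
      rw [← h1] at h0 hb'
      have hcc : (c : ℤ) = c' := by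
        rcases lt_trichotomy (c : ℤ) c' with h | h | h
        · nlinarith
        · exact h
        · nlinarith
      have hs : matProd T 1 0 = matProd T' 1 0 := by
        rw [hcc] at h0
        linarith
      rw [ih T' hT hT' h1 hs, Nat.cast_injective hcc]

/-- The numerator polynomial of `a / b` is palindromic exactly when `b ^ 2 ≡ 1` modulo `a`. -/
lemma reverse_Rpoly_eq_self_iff (L : List ℕ) (hL : ∀ y ∈ L, 2 ≤ y) :
    (Rpoly L).reverse = Rpoly L ↔ matProd L 0 0 ∣ matProd L 1 0 ^ 2 - 1 := by
  have hrev : ∀ y ∈ L.reverse, 2 ≤ y := by simpa using hL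
  have hdet := det_matProd L
  have hb := matProd_bounds L hL
  have hb' := matProd_bounds L.reverse hrev
  rw [reverse_Rpoly L hL]
  simp only [matProd_reverse, Matrix.of_apply, Matrix.cons_val', Matrix.cons_val_zero,
    Matrix.cons_val_one, Matrix.cons_val_fin_one] at hb'
  constructor
  · intro h
    have h1 := (two_mul_eval_one_derivative L hL).1
    have h2 := (two_mul_eval_one_derivative L.reverse hrev).1
    have hd : continuantDegree L.reverse = continuantDegree L := by
      simp [continuantDegree, List.sum_reverse]
    rw [h, h1, hd, matProd_reverse] at h2
    simp at h2
    have hs : matProd L 0 1 = -matProd L 1 0 := by linarith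
    rw [hs] at hdet
    exact ⟨-matProd L 1 1, by linear_combination hdet⟩
  · rintro ⟨k, hk⟩
    have hdvd : matProd L 0 0 ∣ matProd L 1 0 + matProd L 0 1 := by
      refine ⟨matProd L 0 1 * -k + matProd L 1 0 * matProd L 1 1, ?_⟩
      linear_combination (-matProd L 1 0) * hdet - matProd L 0 1 * hk
    have hz : matProd L 1 0 + matProd L 0 1 = 0 := by
      refine Int.eq_zero_of_abs_lt_dvd hdvd (abs_lt.2 ⟨?_, ?_⟩) <;> linarith
    rw [eq_of_matProd_eq L.reverse L hrev hL (by simp [matProd_reverse])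
      (by simp [matProd_reverse]; linarith)]

/-- The square roots of `1` modulo `2 ^ n`. -/
lemma two_pow_dvd_sq_sub_one_iff (n : ℕ) (hn : 2 ≤ n) (r : ℤ) :
    (2 : ℤ) ^ n ∣ r ^ 2 - 1 ↔
      (r ≡ 1 [ZMOD (2 : ℤ) ^ n] ∨ r ≡ -1 [ZMOD (2 : ℤ) ^ n] ∨
       r ≡ 2 ^ (n - 1) + 1 [ZMOD (2 : ℤ) ^ n] ∨
       r ≡ 2 ^ (n - 1) - 1 [ZMOD (2 : ℤ) ^ n]) := by
  obtain ⟨m, rfl⟩ := Nat.exists_eq_add_of_le' hn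
  simp only [show m + 2 - 1 = m + 1 from rfl]
  constructor
  · intro h
    have hodd : Odd r := by
      by_contra hr
      obtain ⟨k, rfl⟩ := Int.not_odd_iff_even.1 hr
      have h2 : (2 : ℤ) ∣ (k + k) ^ 2 - 1 := (dvd_pow_self 2 (by omega)).trans h
      obtain ⟨j, hj⟩ := h2
      ring_nf at hj
      omega
    obtain ⟨k, rfl⟩ := hodd
    have hk : (2 : ℤ) ^ m ∣ k * (k + 1) := by
      have e : (2 * k + 1) ^ 2 - 1 = k * (k + 1) * 2 ^ 2 := by ring
      rw [e, pow_add] at h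
      exact Int.dvd_of_mul_dvd_mul_right (by norm_num) h
    have hcop : ¬ (2 : ℤ) ∣ k ∨ ¬ (2 : ℤ) ∣ k + 1 := by omega
    have hcases : (2 : ℤ) ^ m ∣ k ∨ (2 : ℤ) ^ m ∣ k + 1 := by
      rcases hcop with h2 | h2
      · exact .inr ((Int.prime_two.coprime_iff_not_dvd.2 h2).pow_left.dvd_of_dvd_mul_left hk)
      · exact .inl ((Int.prime_two.coprime_iff_not_dvd.2 h2).pow_left.dvd_of_dvd_mul_right hk)
    rcases hcases with ⟨t, ht⟩ | ⟨t, ht⟩ <;> rcases Int.even_or_odd' t with ⟨u, rfl | rfl⟩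
    · refine .inl (Int.ModEq.symm (Int.modEq_iff_dvd.2 ⟨u, ?_⟩))
      linear_combination 2 * ht
    · refine .inr (.inr (.inl (Int.ModEq.symm (Int.modEq_iff_dvd.2 ⟨u, ?_⟩))))
      linear_combination 2 * ht
    · refine .inr (.inl (Int.ModEq.symm (Int.modEq_iff_dvd.2 ⟨u, ?_⟩)))
      linear_combination 2 * ht
    · refine .inr (.inr (.inr (Int.ModEq.symm (Int.modEq_iff_dvd.2 ⟨u, ?_⟩))))
      linear_combination 2 * ht
  · rintro (h | h | h | h) <;> obtain ⟨t, ht⟩ := Int.modEq_iff_dvd.1 h.symm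
    · exact ⟨t * (r + 1), by linear_combination (r + 1) * ht⟩
    · exact ⟨t * (r - 1), by linear_combination (r - 1) * ht⟩
    · refine ⟨t * (r + 2 ^ (m + 1) + 1) + 2 ^ m + 1, ?_⟩
      linear_combination (r + 2 ^ (m + 1) + 1) * ht
    · refine ⟨t * (r + 2 ^ (m + 1) - 1) + 2 ^ m - 1, ?_⟩
      linear_combination (r + 2 ^ (m + 1) - 1) * ht

/-- For `n ≥ 2` and an irreducible fraction `a/2ⁿ` given by a list `L`: `𝓢(L)` is
palindromic iff `a ≡ ±1 (mod 2ⁿ)` or `a ≡ 2^{n−1} ± 1 (mod 2ⁿ)`. -/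
theorem stmt10 (n : ℕ) (hn : 2 ≤ n)
    (L : List ℕ) (hL : L ≠ []) (hL2 : ∀ y ∈ L, 2 ≤ y)
    (hs : sNum L = 2 ^ n) :
    ((Spoly L).reverse = Spoly L ↔
      (rNum L ≡ 1 [ZMOD (2 : ℤ) ^ n] ∨ rNum L ≡ -1 [ZMOD (2 : ℤ) ^ n] ∨
       rNum L ≡ 2 ^ (n - 1) + 1 [ZMOD (2 : ℤ) ^ n] ∨
       rNum L ≡ 2 ^ (n - 1) - 1 [ZMOD (2 : ℤ) ^ n])) := by
  cases L with
  | nil => exact absurd rfl hL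
  | cons c T =>
    have hT : ∀ y ∈ T, 2 ≤ y := fun y hy => hL2 y (List.mem_cons_of_mem _ hy)
    have ha : matProd T 0 0 = 2 ^ n := by
      rw [← hs, sNum, Spoly_cons, (eval_one_Rpoly_Spoly T).1]
    have hr : rNum (c :: T) = c * 2 ^ n - matProd T 1 0 := by
      rw [rNum, (eval_one_Rpoly_Spoly _).1, matProd_cons_zero, ha]
    rw [Spoly_cons, reverse_Rpoly_eq_self_iff T hT, ha, ← two_pow_dvd_sq_sub_one_iff n hn,
      ← dvd_add_right (a := (2 : ℤ) ^ n)
        (b := 2 ^ n * (c * (c * 2 ^ n - 2 * matProd T 1 0))) (Dvd.intro _ rfl), hr]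
    ring_nf
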